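/- Let L > 0 and M > 0, and let q : [0,L] → ℝ be continuously differentiable with q'(x) < 0 for all x ∈ [0,L], q(0) = M and q(L) = 0, with inverse function q⁻¹ : [0,M] → [0,L]. Define u(y) = (y/(πL)) ∫₀^{q⁻¹(y)} (q(x)² − y²)^{−1/2} dx for y ∈ (0,M). Then all the (improper) integrals below converge and, for every ξ ∈ (0,M), ∫₀^M log((y+ξ)/|y−ξ|) · u(y) dy + (1/L) ∫_{q⁻¹(ξ)}^L (ξ² − q(x)²)^{1/2} dx = ξ. -/

import Mathlib

open MeasureTheory Set

/-- Fundamental theorem of calculus for a nonnegative derivative on an open interval. -/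
theorem intervalIntegrable_and_integral_of_hasDerivAt_of_nonneg {F f : ℝ → ℝ} {a b : ℝ}
    (hab : a ≤ b) (hF : ContinuousOn F (Icc a b))
    (hd : ∀ x ∈ Ioo a b, HasDerivAt F (f x) x) (hf : ∀ x ∈ Ioo a b, 0 ≤ f x) :
    IntervalIntegrable f volume a b ∧ ∫ x in a..b, f x = F b - F a := by
  have hi : IntervalIntegrable f volume a b :=
    (intervalIntegrable_iff_integrableOn_Ioc_of_le hab).2
      (intervalIntegral.integrableOn_deriv_of_nonneg hF hd hf)
  exact ⟨hi, intervalIntegral.integral_eq_sub_of_hasDerivAt_of_le hab hF hd hi⟩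

theorem log_add_div_abs_sub_nonneg {y ξ : ℝ} (hy : 0 ≤ y) (hξ : 0 ≤ ξ) :
    0 ≤ Real.log ((y + ξ) / |y - ξ|) := by
  rcases eq_or_ne y ξ with rfl | h
  · simp
  · have h0 : 0 < |y - ξ| := abs_pos.2 (sub_ne_zero.2 h)
    apply Real.log_nonneg
    rw [le_div_iff₀ h0, one_mul, abs_le]
    constructor <;> linarith

theorem log_add_div_abs_sub {y ξ : ℝ} (h : y + ξ ≠ 0) (h' : y - ξ ≠ 0) :
    Real.log ((y + ξ) / |y - ξ|) = Real.log (y + ξ) - Real.log (y - ξ) := by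
  rw [Real.log_div h (abs_ne_zero.2 h'), Real.log_abs]

theorem hasDerivAt_sqrt_sq_sub_sq {a y : ℝ} (h : y ^ 2 < a ^ 2) :
    HasDerivAt (fun t => √(a ^ 2 - t ^ 2)) (-(y / √(a ^ 2 - y ^ 2))) y := by
  have h1 : HasDerivAt (fun t : ℝ => a ^ 2 - t ^ 2) (-(2 * y)) y := by
    simpa using (hasDerivAt_pow 2 y).const_sub (a ^ 2)
  convert h1.sqrt (by linarith) using 1
  have : √(a ^ 2 - y ^ 2) ≠ 0 := (Real.sqrt_pos.2 (by linarith)).ne'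
  field_simp

theorem hasDerivAt_arcsin_div {a y : ℝ} (ha : 0 < a) (hy : 0 < y) (hya : y < a) :
    HasDerivAt (fun t => Real.arcsin (t / a)) (1 / √(a ^ 2 - y ^ 2)) y := by
  have h1 : y / a < 1 := (div_lt_one ha).2 hya
  have h0 : 0 < y / a := by positivity
  have := (Real.hasDerivAt_arcsin (x := y / a) (by linarith) h1.ne).comp y
    ((hasDerivAt_id y).div_const a)
  refine this.congr_deriv ?_
  have : 1 - (y / a) ^ 2 = (a ^ 2 - y ^ 2) / a ^ 2 := by field_simp
  rw [this, Real.sqrt_div' _ (by positivity), Real.sqrt_sq ha.le]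
  field_simp

/-- An antiderivative of the logarithmic kernel against `y / √(a² - y²)`, for `ξ < a`. -/
noncomputable def logKernelPrimitiveOfLt (a ξ y : ℝ) : ℝ :=
  -(√(a ^ 2 - y ^ 2) + √(a ^ 2 - ξ ^ 2)) * Real.log (y + ξ)
    + (√(a ^ 2 - y ^ 2) - √(a ^ 2 - ξ ^ 2)) * Real.log (y - ξ)
    + 2 * ξ * Real.arcsin (y / a)
    + 2 * √(a ^ 2 - ξ ^ 2) * Real.log (ξ * √(a ^ 2 - y ^ 2) + y * √(a ^ 2 - ξ ^ 2))

theorem hasDerivAt_logKernelPrimitiveOfLt {a ξ y : ℝ} (hξ : 0 < ξ) (hξa : ξ < a) (hy : 0 < y)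
    (hya : y < a) (h : y ≠ ξ) :
    HasDerivAt (logKernelPrimitiveOfLt a ξ)
      (Real.log ((y + ξ) / |y - ξ|) * (y / √(a ^ 2 - y ^ 2))) y := by
  have ha : 0 < a := hξ.trans hξa
  have hd := hasDerivAt_sqrt_sq_sub_sq (a := a) (y := y) (by gcongr)
  have hda := hasDerivAt_arcsin_div ha hy hya
  have hsub : y - ξ ≠ 0 := sub_ne_zero.2 h
  have hadd : y + ξ ≠ 0 := by positivity
  have hy2 : 0 < a ^ 2 - y ^ 2 := sub_pos.2 (by gcongr)
  have hξ2 : 0 < a ^ 2 - ξ ^ 2 := sub_pos.2 (by gcongr)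
  unfold logKernelPrimitiveOfLt
  rw [log_add_div_abs_sub hadd hsub]
  have hs2 := Real.sq_sqrt hy2.le
  have hb2 := Real.sq_sqrt hξ2.le
  have hs := Real.sqrt_pos.2 hy2
  have hb := Real.sqrt_pos.2 hξ2
  generalize √(a ^ 2 - ξ ^ 2) = b at *
  have hlog : ξ * √(a ^ 2 - y ^ 2) + y * b ≠ 0 := by positivity
  have := (((hd.add_const b).neg.mul (((hasDerivAt_id y).add_const ξ).log hadd)).add
    ((hd.sub_const b).mul (((hasDerivAt_id y).sub_const ξ).log hsub))).add
    (hda.const_mul (2 * ξ)) |>.add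
    ((((hd.const_mul ξ).add ((hasDerivAt_id y).mul_const b)).log hlog).const_mul (2 * b))
  refine this.congr_deriv ?_
  simp only [id, Pi.add_apply, Pi.neg_apply]
  generalize √(a ^ 2 - y ^ 2) = s at *
  have key : -(s + b) / (y + ξ) + (s - b) / (y - ξ) + 2 * ξ / s
      + 2 * b * (b - ξ * y / s) / (ξ * s + y * b) = 0 := by
    field_simp
    grind
  linear_combination key

theorem continuousOn_logKernelPrimitiveOfLt {a ξ : ℝ} (hξ : 0 < ξ) (hξa : ξ < a) :
    ContinuousOn (logKernelPrimitiveOfLt a ξ) (Icc 0 a) := by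
  have ha : 0 < a := hξ.trans hξa
  have hξ2 : 0 < a ^ 2 - ξ ^ 2 := sub_pos.2 (by gcongr)
  have hb2 := Real.sq_sqrt hξ2.le
  have hb := Real.sqrt_pos.2 hξ2
  unfold logKernelPrimitiveOfLt
  generalize √(a ^ 2 - ξ ^ 2) = b at *
  have hml : ContinuousOn (fun y : ℝ => -((y + ξ) / (√(a ^ 2 - y ^ 2) + b)) *
      ((y - ξ) * Real.log (y - ξ))) (Icc 0 a) := by
    refine ContinuousOn.mul (ContinuousOn.neg (ContinuousOn.div (by fun_prop) (by fun_prop) ?_))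
      (Real.continuous_mul_log.comp (continuous_sub_right ξ)).continuousOn
    intro y _
    positivity
  have hml' : ContinuousOn (fun y : ℝ => (√(a ^ 2 - y ^ 2) - b) * Real.log (y - ξ))
      (Icc 0 a) := by
    refine hml.congr fun y hy => ?_
    have hy2 : 0 ≤ a ^ 2 - y ^ 2 := sub_nonneg.2 (by have := hy.1; have := hy.2; gcongr)
    have hs2 := Real.sq_sqrt hy2
    have hs := Real.sqrt_nonneg (a ^ 2 - y ^ 2)
    simp only
    rw [← mul_assoc]
    congr 1
    field_simp
    linear_combination hs2 - hb2
  refine ContinuousOn.add (ContinuousOn.add (ContinuousOn.add ?_ hml') ?_) ?_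
  · refine ContinuousOn.mul (by fun_prop) (ContinuousOn.log (by fun_prop) fun y hy => ?_)
    have := hy.1
    positivity
  · exact (continuous_const.mul (Real.continuous_arcsin.comp
      (continuous_id.div_const a))).continuousOn
  · refine ContinuousOn.mul (by fun_prop) (ContinuousOn.log (by fun_prop) fun y hy => ?_)
    rcases hy.1.eq_or_lt with rfl | h
    · simp only [ne_eq, OfNat.ofNat_ne_zero, not_false_eq_true, zero_pow, sub_zero, zero_mul,
        add_zero]
      rw [Real.sqrt_sq ha.le]
      positivity
    · positivity

theorem integral_log_kernel_of_lt {a ξ : ℝ} (hξ : 0 < ξ) (hξa : ξ < a) :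
    IntervalIntegrable (fun y => Real.log ((y + ξ) / |y - ξ|) * (y / √(a ^ 2 - y ^ 2)))
      volume 0 a ∧
    ∫ y in (0:ℝ)..a, Real.log ((y + ξ) / |y - ξ|) * (y / √(a ^ 2 - y ^ 2)) = Real.pi * ξ := by
  have ha : 0 < a := hξ.trans hξa
  have hc := continuousOn_logKernelPrimitiveOfLt hξ hξa
  have hnn : ∀ y, 0 ≤ y → 0 ≤ Real.log ((y + ξ) / |y - ξ|) * (y / √(a ^ 2 - y ^ 2)) :=
    fun y hy => mul_nonneg (log_add_div_abs_sub_nonneg hy hξ.le) (by positivity)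
  obtain ⟨i1, e1⟩ := intervalIntegrable_and_integral_of_hasDerivAt_of_nonneg hξ.le
    (hc.mono (Icc_subset_Icc_right hξa.le))
    (fun y hy => hasDerivAt_logKernelPrimitiveOfLt hξ hξa hy.1 (hy.2.trans hξa) hy.2.ne)
    (fun y hy => hnn y hy.1.le)
  obtain ⟨i2, e2⟩ := intervalIntegrable_and_integral_of_hasDerivAt_of_nonneg hξa.le
    (hc.mono (Icc_subset_Icc_left hξ.le))
    (fun y hy => hasDerivAt_logKernelPrimitiveOfLt hξ hξa (hξ.trans hy.1) hy.2 hy.1.ne')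
    (fun y hy => hnn y (hξ.trans hy.1).le)
  refine ⟨i1.trans i2, ?_⟩
  rw [← intervalIntegral.integral_add_adjacent_intervals i1 i2, e1, e2]
  have hξ2 : 0 < a ^ 2 - ξ ^ 2 := sub_pos.2 (by gcongr)
  have hb2 := Real.sq_sqrt hξ2.le
  have hb := Real.sqrt_pos.2 hξ2
  unfold logKernelPrimitiveOfLt
  generalize √(a ^ 2 - ξ ^ 2) = b at *
  have h1 : Real.log (a + ξ) + Real.log (a - ξ) = 2 * Real.log b := by
    rw [← Real.log_mul (by positivity) (sub_pos.2 hξa).ne', two_mul,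
      ← Real.log_mul hb.ne' hb.ne']
    congr 1
    linear_combination -hb2
  simp only [sub_self, Real.sqrt_zero, mul_zero, zero_add, zero_sub, div_self ha.ne',
    Real.arcsin_one, ne_eq, OfNat.ofNat_ne_zero, not_false_eq_true, zero_pow, sub_zero,
    Real.sqrt_sq ha.le, zero_div, Real.arcsin_zero, zero_mul, add_zero, Real.log_neg_eq_log]
  rw [Real.log_mul ha.ne' hb.ne', Real.log_mul hξ.ne' ha.ne']
  linear_combination -b * h1

/-- An antiderivative of the logarithmic kernel against `y / √(a² - y²)`, for `a < ξ`. -/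
noncomputable def logKernelPrimitiveOfGt (a ξ y : ℝ) : ℝ :=
  √(a ^ 2 - y ^ 2) * (Real.log (y - ξ) - Real.log (y + ξ))
    + 2 * ξ * Real.arcsin (y / a)
    - 2 * √(ξ ^ 2 - a ^ 2) * Real.arcsin (y * √(ξ ^ 2 - a ^ 2) / (a * √(ξ ^ 2 - y ^ 2)))

theorem hasDerivAt_arcsin_mul_div_sqrt {a ξ y : ℝ} (hξa : a < ξ) (hy : 0 < y)
    (hya : y < a) :
    HasDerivAt (fun t => Real.arcsin (t * √(ξ ^ 2 - a ^ 2) / (a * √(ξ ^ 2 - t ^ 2))))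
      (ξ * √(ξ ^ 2 - a ^ 2) / ((ξ ^ 2 - y ^ 2) * √(a ^ 2 - y ^ 2))) y := by
  have ha : 0 < a := hy.trans hya
  have hξ : 0 < ξ := ha.trans hξa
  have hyξ : y < ξ := hya.trans hξa
  have hd := hasDerivAt_sqrt_sq_sub_sq (a := ξ) (y := y) (by gcongr)
  have hs0 : 0 < a ^ 2 - y ^ 2 := sub_pos.2 (by gcongr)
  have hb0 : 0 < ξ ^ 2 - a ^ 2 := sub_pos.2 (by gcongr)
  have hr0 : 0 < ξ ^ 2 - y ^ 2 := sub_pos.2 (by gcongr)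
  have hs2 := Real.sq_sqrt hs0.le
  have hb2 := Real.sq_sqrt hb0.le
  have hr2 := Real.sq_sqrt hr0.le
  have hs := Real.sqrt_pos.2 hs0
  have hb := Real.sqrt_pos.2 hb0
  have hr := Real.sqrt_pos.2 hr0
  generalize √(ξ ^ 2 - a ^ 2) = b at *
  have har : a * √(ξ ^ 2 - y ^ 2) ≠ 0 := by positivity
  have hg := ((hasDerivAt_id y).mul_const b).div (hd.const_mul a) har
  have hsq : 1 - (y * b / (a * √(ξ ^ 2 - y ^ 2))) ^ 2
      = (√(a ^ 2 - y ^ 2) * ξ / (a * √(ξ ^ 2 - y ^ 2))) ^ 2 := by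
    generalize √(ξ ^ 2 - y ^ 2) = r at *
    generalize √(a ^ 2 - y ^ 2) = s at *
    field_simp
    grind
  have hpos : 0 < 1 - (y * b / (a * √(ξ ^ 2 - y ^ 2))) ^ 2 := by
    rw [hsq]; positivity
  have := (Real.hasDerivAt_arcsin (x := y * b / (a * √(ξ ^ 2 - y ^ 2)))
    (by intro h; rw [h] at hpos; norm_num at hpos)
    (by intro h; rw [h] at hpos; norm_num at hpos)).comp y hg
  refine this.congr_deriv ?_
  rw [hsq, Real.sqrt_sq (by positivity), ← hr2]
  simp only [id, hr2]
  generalize √(ξ ^ 2 - y ^ 2) = r at *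
  generalize √(a ^ 2 - y ^ 2) = s at *
  field_simp
  grind

theorem hasDerivAt_logKernelPrimitiveOfGt {a ξ y : ℝ} (hξa : a < ξ) (hy : 0 < y)
    (hya : y < a) :
    HasDerivAt (logKernelPrimitiveOfGt a ξ)
      (Real.log ((y + ξ) / |y - ξ|) * (y / √(a ^ 2 - y ^ 2))) y := by
  have ha : 0 < a := hy.trans hya
  have hξ : 0 < ξ := ha.trans hξa
  have hd := hasDerivAt_sqrt_sq_sub_sq (a := a) (y := y) (by gcongr)
  have hsub : y - ξ ≠ 0 := by linarith
  have hadd : y + ξ ≠ 0 := by positivity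
  have hs0 : 0 < a ^ 2 - y ^ 2 := sub_pos.2 (by gcongr)
  have hb0 : 0 < ξ ^ 2 - a ^ 2 := sub_pos.2 (by gcongr)
  have hr0 : ξ ^ 2 - y ^ 2 = -((y + ξ) * (y - ξ)) := by ring
  have hs2 := Real.sq_sqrt hs0.le
  have hb2 := Real.sq_sqrt hb0.le
  have hs := Real.sqrt_pos.2 hs0
  unfold logKernelPrimitiveOfGt
  rw [log_add_div_abs_sub hadd hsub]
  have := ((hd.mul ((((hasDerivAt_id y).sub_const ξ).log hsub).sub
    (((hasDerivAt_id y).add_const ξ).log hadd))).add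
    ((hasDerivAt_arcsin_div ha hy hya).const_mul (2 * ξ))).sub
    ((hasDerivAt_arcsin_mul_div_sqrt hξa hy hya).const_mul (2 * √(ξ ^ 2 - a ^ 2)))
  refine this.congr_deriv ?_
  simp only [id, hr0, Pi.sub_apply]
  generalize √(ξ ^ 2 - a ^ 2) = b at *
  generalize √(a ^ 2 - y ^ 2) = s at *
  have key : s * (1 / (y - ξ) - 1 / (y + ξ)) + 2 * ξ * (1 / s)
      - 2 * b * (ξ * b / (-((y + ξ) * (y - ξ)) * s)) = 0 := by
    field_simp
    grind
  linear_combination key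

theorem integral_log_kernel_of_gt {a ξ : ℝ} (ha : 0 < a) (hξa : a < ξ) :
    IntervalIntegrable (fun y => Real.log ((y + ξ) / |y - ξ|) * (y / √(a ^ 2 - y ^ 2)))
      volume 0 a ∧
    ∫ y in (0:ℝ)..a, Real.log ((y + ξ) / |y - ξ|) * (y / √(a ^ 2 - y ^ 2))
      = Real.pi * (ξ - √(ξ ^ 2 - a ^ 2)) := by
  have hξ : 0 < ξ := ha.trans hξa
  have hb0 : 0 < ξ ^ 2 - a ^ 2 := sub_pos.2 (by gcongr)
  have hc : ContinuousOn (logKernelPrimitiveOfGt a ξ) (Icc 0 a) := by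
    unfold logKernelPrimitiveOfGt
    refine ContinuousOn.sub (ContinuousOn.add ?_ ?_) ?_
    · refine ContinuousOn.mul (by fun_prop) (ContinuousOn.sub
        (ContinuousOn.log (by fun_prop) fun y hy => ?_)
        (ContinuousOn.log (by fun_prop) fun y hy => ?_))
      · have := hy.2; linarith
      · have := hy.1; positivity
    · exact (continuous_const.mul (Real.continuous_arcsin.comp
        (continuous_id.div_const a))).continuousOn
    · refine ContinuousOn.mul (by fun_prop) (Real.continuous_arcsin.comp_continuousOn
        (ContinuousOn.div (by fun_prop) (by fun_prop) fun y hy => ?_))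
      have h2 : y < ξ := hy.2.trans_lt hξa
      have h1 := hy.1
      have : 0 < ξ ^ 2 - y ^ 2 := sub_pos.2 (by gcongr)
      positivity
  obtain ⟨i, e⟩ := intervalIntegrable_and_integral_of_hasDerivAt_of_nonneg ha.le hc
    (fun y hy => hasDerivAt_logKernelPrimitiveOfGt hξa hy.1 hy.2)
    (fun y hy => mul_nonneg (log_add_div_abs_sub_nonneg hy.1.le hξ.le)
      (div_nonneg hy.1.le (Real.sqrt_nonneg _)))
  refine ⟨i, ?_⟩
  have hb := Real.sqrt_pos.2 hb0
  rw [e]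
  unfold logKernelPrimitiveOfGt
  simp only [sub_self, Real.sqrt_zero, zero_mul, div_self ha.ne', Real.arcsin_one,
    div_self (mul_pos ha hb).ne', zero_div, Real.arcsin_zero, zero_sub, zero_add,
    Real.log_neg_eq_log]
  ring

theorem integral_log_kernel {a ξ : ℝ} (ha : 0 < a) (hξ : 0 < ξ) (h : a ≠ ξ) :
    IntervalIntegrable (fun y => Real.log ((y + ξ) / |y - ξ|) * (y / √(a ^ 2 - y ^ 2)))
      volume 0 a ∧
    ∫ y in (0:ℝ)..a, Real.log ((y + ξ) / |y - ξ|) * (y / √(a ^ 2 - y ^ 2))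
      = Real.pi * (ξ - √(ξ ^ 2 - a ^ 2)) := by
  rcases h.lt_or_gt with h | h
  · exact integral_log_kernel_of_gt ha h
  · have := integral_log_kernel_of_lt hξ h
    rwa [Real.sqrt_eq_zero_of_nonpos (sub_nonpos.2 (by gcongr)), sub_zero]

theorem exists_pos_mul_sub_le_of_derivWithin_neg {q : ℝ → ℝ} {L : ℝ} (hL : 0 < L)
    (hq : ContDiffOn ℝ 1 q (Icc 0 L))
    (hq' : ∀ x ∈ Icc (0:ℝ) L, derivWithin q (Icc 0 L) x < 0) :
    ∃ c > 0, ∀ x ∈ Icc 0 L, ∀ z ∈ Icc 0 L, x ≤ z → c * (z - x) ≤ q x - q z := by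
  obtain ⟨x₀, hx₀, hmax⟩ := isCompact_Icc.exists_isMaxOn (nonempty_Icc.2 hL.le)
    (hq.continuousOn_derivWithin (uniqueDiffOn_Icc hL) le_rfl)
  refine ⟨-derivWithin q (Icc 0 L) x₀, neg_pos.2 (hq' x₀ hx₀), fun x hx z hz hxz => ?_⟩
  have hd : ∀ w ∈ interior (Icc 0 L), DifferentiableAt ℝ q w := fun w hw =>
    ((hq.differentiableOn one_ne_zero) w (interior_subset hw)).differentiableAt
      (mem_interior_iff_mem_nhds.1 hw)
  have := (convex_Icc 0 L).mul_sub_le_image_sub_of_le_deriv (f := fun w => -q w)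
    (C := -derivWithin q (Icc 0 L) x₀) hq.continuousOn.neg
    (fun w hw => (hd w hw).neg.differentiableWithinAt) (fun w hw => ?_) x hx z hz hxz
  · linarith
  · rw [deriv.fun_neg, ← derivWithin_of_mem_nhds (mem_interior_iff_mem_nhds.1 hw)]
    exact neg_le_neg (hmax (interior_subset hw))

/-- The inverse square root singularity at the turning point `x₀` is integrable when `q`
decreases to `y` at least linearly. -/
theorem intervalIntegrable_inv_sqrt_sq_sub_sq {q : ℝ → ℝ} {x₀ y c : ℝ} (hx₀ : 0 ≤ x₀)
    (hq : ContinuousOn q (Icc 0 x₀)) (hy : 0 < y) (hc : 0 < c)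
    (hle : ∀ x ∈ Icc 0 x₀, y + c * (x₀ - x) ≤ q x) :
    IntervalIntegrable (fun x => 1 / √(q x ^ 2 - y ^ 2)) volume 0 x₀ := by
  have hr : IntervalIntegrable (fun x => 1 / √(2 * y * c) * (x₀ - x) ^ (-(1 / 2) : ℝ))
      volume 0 x₀ := by
    have := (intervalIntegral.intervalIntegrable_rpow' (a := x₀) (b := 0) (r := -(1 / 2))
      (by norm_num)).comp_sub_left x₀
    simp only [sub_self, sub_zero] at this
    exact this.const_mul _
  refine hr.mono_fun ?_ ?_
  · rw [uIoc_of_le hx₀]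
    have hm : AEMeasurable q (volume.restrict (Ioc 0 x₀)) :=
      (hq.mono Ioc_subset_Icc_self).aemeasurable measurableSet_Ioc
    exact (((hm.pow_const 2).sub_const _).sqrt.const_div 1).aestronglyMeasurable
  · rw [uIoc_of_le hx₀]
    filter_upwards [ae_restrict_mem measurableSet_Ioc, Measure.ae_ne _ x₀] with x hx hne
    have hd : 0 < x₀ - x := sub_pos.2 (hx.2.lt_of_ne hne)
    rw [Real.norm_of_nonneg (by positivity), Real.norm_of_nonneg (by positivity),
      Real.rpow_neg hd.le, ← Real.sqrt_eq_rpow, ← one_div, div_mul_div_comm, one_mul,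
      ← Real.sqrt_mul (by positivity)]
    have hx' := hle x ⟨hx.1.le, hx.2⟩
    have hp : 0 < c * (x₀ - x) := by positivity
    refine one_div_le_one_div_of_le (Real.sqrt_pos.2 (by positivity)) (Real.sqrt_le_sqrt ?_)
    nlinarith

theorem integrable_log_kernel_prod {q : ℝ → ℝ} {L M ξ x₀ : ℝ}
    (hq : ContinuousOn q (Icc 0 L)) (hqM : ∀ x ∈ Ioo 0 L, q x ∈ Ioo 0 M) (hξ : 0 < ξ)
    (hx₀ : ∀ x ∈ Ioo 0 L, q x = ξ → x = x₀) :
    Integrable (Function.uncurry fun x y =>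
        Real.log ((y + ξ) / |y - ξ|) * (y / √(q x ^ 2 - y ^ 2)))
      ((volume.restrict (Ioo 0 L)).prod (volume.restrict (Ioo 0 M))) ∧
    ∀ᵐ x ∂(volume.restrict (Ioo 0 L)),
      ∫ y in Ioo 0 M, Real.log ((y + ξ) / |y - ξ|) * (y / √(q x ^ 2 - y ^ 2))
        = Real.pi * (ξ - √(ξ ^ 2 - q x ^ 2)) := by
  have hslice : ∀ᵐ x ∂(volume.restrict (Ioo 0 L)),
      IntegrableOn (fun y => Real.log ((y + ξ) / |y - ξ|) * (y / √(q x ^ 2 - y ^ 2)))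
        (Ioo 0 M) ∧
      ∫ y in Ioo 0 M, Real.log ((y + ξ) / |y - ξ|) * (y / √(q x ^ 2 - y ^ 2))
        = Real.pi * (ξ - √(ξ ^ 2 - q x ^ 2)) := by
    filter_upwards [ae_restrict_mem measurableSet_Ioo, Measure.ae_ne _ x₀] with x hx hne
    obtain ⟨h0, hM⟩ := hqM x hx
    obtain ⟨hi, he⟩ := integral_log_kernel h0 hξ (fun h => hne (hx₀ x hx h))
    have hz : ∀ y ∈ Ioo 0 M \ Ioo 0 (q x),
        Real.log ((y + ξ) / |y - ξ|) * (y / √(q x ^ 2 - y ^ 2)) = 0 := by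
      rintro y ⟨hy, hy'⟩
      have hle : q x ≤ y := not_lt.1 fun h => hy' ⟨hy.1, h⟩
      rw [Real.sqrt_eq_zero_of_nonpos (sub_nonpos.2 (by gcongr)), div_zero, mul_zero]
    have hsub : Ioo 0 (q x) ⊆ Ioo 0 M := Ioo_subset_Ioo_right hM.le
    refine ⟨((intervalIntegrable_iff_integrableOn_Ioo_of_le h0.le).1 hi).of_forall_sdiff_eq_zero
      measurableSet_Ioo hz, ?_⟩
    rw [setIntegral_eq_of_subset_of_forall_sdiff_eq_zero measurableSet_Ioo hsub hz,
      ← integral_Ioc_eq_integral_Ioo, ← intervalIntegral.integral_of_le h0.le, he]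
  have hqm : AEMeasurable q (volume.restrict (Ioo 0 L)) :=
    (hq.mono Ioo_subset_Icc_self).aemeasurable measurableSet_Ioo
  refine ⟨?_, hslice.mono fun x hx => hx.2⟩
  rw [integrable_prod_iff]
  · refine ⟨hslice.mono fun x hx => hx.1, ?_⟩
    have hcont : ContinuousOn (fun x => Real.pi * (ξ - √(ξ ^ 2 - q x ^ 2))) (Icc 0 L) := by
      fun_prop
    refine ((hcont.integrableOn_Icc).mono_set Ioo_subset_Icc_self).congr ?_
    filter_upwards [hslice] with x hx
    rw [← hx.2]
    refine setIntegral_congr_fun measurableSet_Ioo fun y hy => ?_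
    exact (Real.norm_of_nonneg (mul_nonneg (log_add_div_abs_sub_nonneg hy.1.le hξ.le)
      (div_nonneg hy.1.le (Real.sqrt_nonneg _)))).symm
  · have h1 : AEMeasurable (fun z : ℝ × ℝ => q z.1)
        ((volume.restrict (Ioo 0 L)).prod (volume.restrict (Ioo 0 M))) := hqm.comp_fst
    have h2 : Measurable fun z : ℝ × ℝ => Real.log ((z.2 + ξ) / |z.2 - ξ|) := by fun_prop
    exact (h2.aemeasurable.mul (measurable_snd.aemeasurable.div
      ((h1.pow_const 2).sub (measurable_snd.pow_const 2).aemeasurable).sqrt)).aestronglyMeasurable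

/-- Theorem 4.1 of the paper (periodic fNLS soliton gas), in real variables:
the density of states `u(y) = (y/(πL)) ∫₀^{q⁻¹(y)} (q(x)² − y²)^{−1/2} dx`
solves the soliton-gas nonlinear dispersion relation. -/
theorem stmt_0
    (L M : ℝ) (hL : 0 < L) (hM : 0 < M)
    (q qinv : ℝ → ℝ)
    (hq : ContDiffOn ℝ 1 q (Icc 0 L))
    (hq' : ∀ x ∈ Icc (0:ℝ) L, derivWithin q (Icc 0 L) x < 0)
    (hq0 : q 0 = M) (hqL : q L = 0)
    (hinv_left : ∀ x ∈ Icc (0:ℝ) L, qinv (q x) = x)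
    (hinv_right : ∀ y ∈ Icc (0:ℝ) M, q (qinv y) = y)
    (u : ℝ → ℝ)
    (hu : ∀ y ∈ Ioo (0:ℝ) M,
      u y = (y / (Real.pi * L)) * ∫ x in (0:ℝ)..(qinv y), 1 / Real.sqrt (q x ^ 2 - y ^ 2)) :
    (∀ y ∈ Ioo (0:ℝ) M,
      IntervalIntegrable (fun x => 1 / Real.sqrt (q x ^ 2 - y ^ 2)) volume 0 (qinv y)) ∧
    (∀ ξ ∈ Ioo (0:ℝ) M,
      IntervalIntegrable (fun y => Real.log ((y + ξ) / |y - ξ|) * u y) volume 0 M ∧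
      IntervalIntegrable (fun x => Real.sqrt (ξ ^ 2 - q x ^ 2)) volume (qinv ξ) L ∧
      (∫ y in (0:ℝ)..M, Real.log ((y + ξ) / |y - ξ|) * u y)
        + (1 / L) * ∫ x in (qinv ξ)..L, Real.sqrt (ξ ^ 2 - q x ^ 2) = ξ) := by
  have hcont : ContinuousOn q (Icc 0 L) := hq.continuousOn
  obtain ⟨c, hc, hlin⟩ := exists_pos_mul_sub_le_of_derivWithin_neg hL hq hq'
  have hanti : StrictAntiOn q (Icc 0 L) := fun x hx z hz hxz => by
    have := hlin x hx z hz hxz.le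
    have := mul_pos hc (sub_pos.2 hxz)
    linarith
  have hqinv : ∀ y ∈ Icc 0 M, qinv y ∈ Icc 0 L := by
    intro y hy
    obtain ⟨x, hx, rfl⟩ := intermediate_value_Icc' hL.le hcont (by rwa [hq0, hqL])
    rwa [hinv_left x hx]
  have h0L : (0:ℝ) ∈ Icc 0 L := left_mem_Icc.2 hL.le
  have hLL : L ∈ Icc 0 L := right_mem_Icc.2 hL.le
  have hqM : ∀ x ∈ Ioo 0 L, q x ∈ Ioo 0 M := fun x hx =>
    ⟨hqL ▸ hanti ⟨hx.1.le, hx.2.le⟩ hLL hx.2, hq0 ▸ hanti h0L ⟨hx.1.le, hx.2.le⟩ hx.1⟩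
  have hslice : ∀ y ∈ Ioo (0:ℝ) M,
      IntervalIntegrable (fun x => 1 / √(q x ^ 2 - y ^ 2)) volume 0 (qinv y) := by
    intro y hy
    have hmem := hqinv y ⟨hy.1.le, hy.2.le⟩
    refine intervalIntegrable_inv_sqrt_sq_sub_sq hmem.1
      (hcont.mono (Icc_subset_Icc_right hmem.2)) hy.1 hc fun x hx => ?_
    have := hlin x ⟨hx.1, hx.2.trans hmem.2⟩ _ hmem hx.2
    rw [hinv_right y ⟨hy.1.le, hy.2.le⟩] at this
    linarith
  refine ⟨hslice, fun ξ hξ => ?_⟩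
  have hξI : ξ ∈ Icc 0 M := ⟨hξ.1.le, hξ.2.le⟩
  have hξmem := hqinv ξ hξI
  obtain ⟨hK, hKx⟩ := integrable_log_kernel_prod (x₀ := qinv ξ) hcont hqM hξ.1
    (fun x hx h => by rw [← h, hinv_left x ⟨hx.1.le, hx.2.le⟩])
  have hKy : ∀ y ∈ Ioo 0 M,
      ∫ x in Ioo 0 L, Real.log ((y + ξ) / |y - ξ|) * (y / √(q x ^ 2 - y ^ 2))
        = Real.pi * L * (Real.log ((y + ξ) / |y - ξ|) * u y) := by
    intro y hy
    have hyI : y ∈ Icc 0 M := ⟨hy.1.le, hy.2.le⟩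
    have hmem := hqinv y hyI
    have hz : ∀ x ∈ Ioc 0 L \ Ioc 0 (qinv y), 1 / √(q x ^ 2 - y ^ 2) = 0 := by
      rintro x ⟨hx, hx'⟩
      have hle : qinv y ≤ x := (not_le.1 fun h => hx' ⟨hx.1, h⟩).le
      have hxI : x ∈ Icc 0 L := ⟨hx.1.le, hx.2⟩
      have h1 : q x ≤ y := hinv_right y hyI ▸ hanti.antitoneOn hmem hxI hle
      have h0 : 0 ≤ q x := hqL ▸ hanti.antitoneOn hxI hLL hx.2
      rw [Real.sqrt_eq_zero_of_nonpos (sub_nonpos.2 (by gcongr)), div_zero]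
    rw [hu y hy, intervalIntegral.integral_of_le hmem.1,
      ← setIntegral_eq_of_subset_of_forall_sdiff_eq_zero measurableSet_Ioc
        (Ioc_subset_Ioc_right hmem.2) hz, integral_Ioc_eq_integral_Ioo]
    simp only [div_eq_mul_inv y (√_), ← one_div (√_)]
    rw [integral_const_mul, integral_const_mul]
    field_simp
  have hsqrt : ContinuousOn (fun x => √(ξ ^ 2 - q x ^ 2)) (Icc 0 L) := by fun_prop
  have hsqrt1 : IntervalIntegrable (fun x => √(ξ ^ 2 - q x ^ 2)) volume 0 (qinv ξ) :=
    (hsqrt.mono (Icc_subset_Icc_right hξmem.2)).intervalIntegrable_of_Icc hξmem.1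
  have hsqrt2 : IntervalIntegrable (fun x => √(ξ ^ 2 - q x ^ 2)) volume (qinv ξ) L :=
    (hsqrt.mono (Icc_subset_Icc_left hξmem.1)).intervalIntegrable_of_Icc hξmem.2
  have hpi : Real.pi * L ≠ 0 := by positivity
  refine ⟨?_, hsqrt2, ?_⟩
  · rw [intervalIntegrable_iff_integrableOn_Ioo_of_le hM.le]
    refine (hK.integral_prod_right.const_mul (Real.pi * L)⁻¹).congr ?_
    filter_upwards [ae_restrict_mem measurableSet_Ioo] with y hy
    simp only [Function.uncurry_apply_pair]
    rw [hKy y hy, inv_mul_cancel_left₀ hpi]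
  · have hzero : ∫ x in (0:ℝ)..(qinv ξ), √(ξ ^ 2 - q x ^ 2) = 0 := by
      refine (intervalIntegral.integral_congr (g := fun _ => (0:ℝ)) fun x hx => ?_).trans
        intervalIntegral.integral_zero
      rw [uIcc_of_le hξmem.1] at hx
      have h1 : ξ ≤ q x :=
        (hinv_right ξ hξI).symm.le.trans
          (hanti.antitoneOn ⟨hx.1, hx.2.trans hξmem.2⟩ hξmem hx.2)
      have h0 := hξ.1.le
      exact Real.sqrt_eq_zero_of_nonpos (sub_nonpos.2 (by gcongr))
    have hswap := integral_integral_swap hK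
    rw [integral_congr_ae hKx, setIntegral_congr_fun measurableSet_Ioo hKy, integral_const_mul,
      integral_const_mul, ← integral_Ioc_eq_integral_Ioo, ← integral_Ioc_eq_integral_Ioo,
      ← intervalIntegral.integral_of_le hL.le, ← intervalIntegral.integral_of_le hM.le,
      intervalIntegral.integral_sub intervalIntegrable_const (hsqrt1.trans hsqrt2),
      ← intervalIntegral.integral_add_adjacent_intervals hsqrt1 hsqrt2, hzero,
      intervalIntegral.integral_const, mul_assoc] at hswap
    have hcancel := mul_left_cancel₀ Real.pi_ne_zero hswap
    simp only [sub_zero, smul_eq_mul, zero_add] at hcancel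
    field_simp
    linear_combination -hcancel
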